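/- Let p > 24138 be a prime and let S be a sequence of p elements of ℤ/pℤ \ {0} containing the element 1, such that S contains no nonempty subsequence with index p and such that m(S) = M(S). Put M = M(S) and k = ⌊p/M⌋, and let t ∈ [2, k]. Let 1 = a_1 < a_2 < a_3 < ⋯ be all positive integers coprime to t, listed in increasing order. Let w, u ≥ 0 be integers, and suppose M ≤ (p − 2t + w·a_{u+1} + 2)/(t + Σ_{i=2}^{u} a_i). Then |R_t| ≤ (p − (t + Σ_{i=2}^{u} a_i)·M − 2t + 2)/a_{u+1} + δ_u·(u−1)·M + 2t + w, where δ_u = 0 if u = 0 and δ_u = 1 if u ≥ 1. -/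

import Mathlib

/-- `|x|ₚ`: the smallest positive integer in the residue class `x` modulo `p`
(so `|0|ₚ = p`). -/
def nval (p : ℕ) (x : ZMod p) : ℕ := if x = 0 then p else x.val

/-- `σ(|mS|ₚ)`: the sum of `|m·a|ₚ` over all terms `a` of `S`. -/
def sigmaM (p : ℕ) (m : ℤ) (S : Multiset (ZMod p)) : ℕ :=
  (S.map fun a => nval p (m • a)).sum

/-- `σ(|S|ₚ)`: the sum of `|a|ₚ` over all terms `a` of `S`. -/
def sigmaOne (p : ℕ) (S : Multiset (ZMod p)) : ℕ :=
  (S.map (nval p)).sum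

/-- `Σ_Index(S) = { σ(|T|ₚ) : T a subsequence of S with 1 ≤ σ(|T|ₚ) ≤ p }`. -/
def SigmaIndex (p : ℕ) (S : Multiset (ZMod p)) : Set ℕ :=
  {s | ∃ T ≤ S, s = sigmaOne p T ∧ 1 ≤ s ∧ s ≤ p}

/-- `M(S)`: the maximal integer `t` such that `Σ_Index(T) = [1, t]` holds for
some subsequence `T` of `S`. -/
noncomputable def Mfun (p : ℕ) (S : Multiset (ZMod p)) : ℕ :=
  sSup {t | ∃ T ≤ S, SigmaIndex p T = Set.Icc 1 t}

/-- `m(S) = max { M(|rS|ₚ) : r ∈ [1, p-1] }`. -/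
noncomputable def mfun (p : ℕ) (S : Multiset (ZMod p)) : ℕ :=
  sSup {t | ∃ r : ℕ, 1 ≤ r ∧ r ≤ p - 1 ∧
    t = Mfun p (S.map fun x => (r : ZMod p) * x)}

/-- `Rᵢ`: the subsequence of `S` consisting of those terms `x` with
`1 ≤ |ix|ₚ ≤ M` and `gcd(|ix|ₚ, i) = 1`. -/
def Rseq (p : ℕ) (M : ℕ) (S : Multiset (ZMod p)) (i : ℕ) : Multiset (ZMod p) :=
  S.filter fun x => 1 ≤ nval p ((i : ZMod p) * x) ∧
    nval p ((i : ZMod p) * x) ≤ M ∧ Nat.Coprime (nval p ((i : ZMod p) * x)) i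

/-- Sum of `f` over a multiset. -/
def fsum {α : Type*} (f : α → ℕ) (W : Multiset α) : ℕ := (W.map f).sum

theorem fsum_zero {α : Type*} (f : α → ℕ) : fsum f 0 = 0 := by simp [fsum]

theorem fsum_cons {α : Type*} (f : α → ℕ) (x : α) (W : Multiset α) :
    fsum f (x ::ₘ W) = f x + fsum f W := by simp [fsum]

theorem fsum_add {α : Type*} (f : α → ℕ) (V W : Multiset α) :
    fsum f (V + W) = fsum f V + fsum f W := by simp [fsum]

theorem fsum_mono {α : Type*} (f : α → ℕ) {V W : Multiset α} (h : V ≤ W) :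
    fsum f V ≤ fsum f W := by
  obtain ⟨U, rfl⟩ := Multiset.le_iff_exists_add.1 h
  rw [fsum_add]; omega

theorem fsum_le {α : Type*} (f : α → ℕ) (M : ℕ) (W : Multiset α) (h : ∀ x ∈ W, f x ≤ M) :
    fsum f W ≤ Multiset.card W * M := by
  induction W using Multiset.induction_on with
  | empty => simp [fsum]
  | cons x W ih =>
    rw [fsum_cons, Multiset.card_cons]
    have h1 := ih (fun y hy => h y (Multiset.mem_cons_of_mem hy))
    have h2 := h x (Multiset.mem_cons_self x W)
    nlinarith

theorem exists_sub_card {α : Type*} {s : Multiset α} {n : ℕ} (h : n ≤ Multiset.card s) :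
    ∃ V ≤ s, Multiset.card V = n := by
  induction s using Multiset.induction_on with
  | empty => exact ⟨0, le_rfl, by simp at h; simp [h]⟩
  | cons x W ih =>
    by_cases hc : n ≤ Multiset.card W
    · obtain ⟨V, hV, h1⟩ := ih hc
      exact ⟨V, hV.trans (Multiset.le_cons_self W x), h1⟩
    · refine ⟨x ::ₘ W, le_rfl, ?_⟩
      rw [Multiset.card_cons] at h ⊢
      omega

theorem greedy {α : Type*} (f : α → ℕ) (M X : ℕ) (hM : 0 < M) (W : Multiset α)
    (h : ∀ x ∈ W, f x ≤ M) (hX : X ≤ fsum f W) :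
    ∃ V ≤ W, X ≤ fsum f V ∧ fsum f V < X + M := by
  induction W using Multiset.induction_on with
  | empty => exact ⟨0, le_rfl, hX, by rw [fsum_zero]; omega⟩
  | cons x W ih =>
    by_cases hc : X ≤ fsum f W
    · obtain ⟨V, hV, h1⟩ := ih (fun y hy => h y (Multiset.mem_cons_of_mem hy)) hc
      exact ⟨V, hV.trans (Multiset.le_cons_self W x), h1⟩
    · refine ⟨x ::ₘ W, le_rfl, hX, ?_⟩
      have h2 := h x (Multiset.mem_cons_self x W)
      rw [fsum_cons]; omega

theorem shift_grow (t : ℕ) [NeZero t] (A : Finset (ZMod t)) (b : (ZMod t)ˣ) (a : ZMod t)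
    (ha : a ∈ A) (h : ∀ x ∈ A, x + b ∈ A) : A = Finset.univ := by
  have key : ∀ n : ℕ, a + n * (b : ZMod t) ∈ A := by
    intro n
    induction n with
    | zero => simpa using ha
    | succ n ih =>
      have := h _ ih
      convert this using 1
      push_cast; ring
  ext c
  simp only [Finset.mem_univ, iff_true]
  have := key ((c - a) * ((b⁻¹ : (ZMod t)ˣ) : ZMod t)).val
  rw [ZMod.natCast_zmod_val, mul_assoc, Units.inv_mul] at this
  simpa using this

theorem residues {α : Type*} (f : α → ℕ) (t : ℕ) [NeZero t] (W : Multiset α)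
    (h : ∀ x ∈ W, Nat.Coprime (f x) t) :
    ∃ A : Finset (ZMod t), min t (Multiset.card W + 1) ≤ A.card ∧
      ∀ c ∈ A, ∃ U ≤ W, ((fsum f U : ℕ) : ZMod t) = c := by
  classical
  induction W using Multiset.induction_on with
  | empty =>
    refine ⟨{0}, by simp, ?_⟩
    intro c hc
    refine ⟨0, le_rfl, ?_⟩
    rw [Finset.mem_singleton] at hc
    simp [hc, fsum]
  | cons x W ih =>
    obtain ⟨A, hA, hU⟩ := ih (fun y hy => h y (Multiset.mem_cons_of_mem hy))
    have hx := h x (Multiset.mem_cons_self x W)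
    have ht : 0 < t := Nat.pos_of_ne_zero (NeZero.ne t)
    by_cases hc : ∀ y ∈ A, y + (ZMod.unitOfCoprime (f x) hx : ZMod t) ∈ A
    · have hne : A.Nonempty := by
        rw [← Finset.card_pos]; omega
      obtain ⟨a, ha⟩ := hne
      have := shift_grow t A _ a ha hc
      refine ⟨A, ?_, ?_⟩
      · rw [this, Finset.card_univ, ZMod.card]; omega
      · intro c hc
        obtain ⟨U, hUW, e⟩ := hU c hc
        exact ⟨U, hUW.trans (Multiset.le_cons_self W x), e⟩
    · push Not at hc
      obtain ⟨y, hy, hyn⟩ := hc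
      rw [ZMod.coe_unitOfCoprime] at hyn
      refine ⟨insert (y + (f x : ZMod t)) A, ?_, ?_⟩
      · rw [Finset.card_insert_of_notMem hyn, Multiset.card_cons]; omega
      · intro c hc
        rw [Finset.mem_insert] at hc
        rcases hc with rfl | hc
        · obtain ⟨U, hUW, e⟩ := hU y hy
          refine ⟨x ::ₘ U, Multiset.cons_le_cons x hUW, ?_⟩
          rw [fsum_cons]; push_cast; rw [e, add_comm]
        · obtain ⟨U, hUW, e⟩ := hU c hc
          exact ⟨U, hUW.trans (Multiset.le_cons_self W x), e⟩

theorem residues_full {α : Type*} (f : α → ℕ) (t : ℕ) (ht : 0 < t) (W : Multiset α)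
    (h : ∀ x ∈ W, Nat.Coprime (f x) t) (hc : t ≤ Multiset.card W + 1) (n : ℕ) :
    ∃ U ≤ W, fsum f U ≡ n [MOD t] := by
  have : NeZero t := ⟨ht.ne'⟩
  obtain ⟨A, hA, hU⟩ := residues f t W h
  have : A = Finset.univ := by
    rw [← Finset.card_eq_iff_eq_univ, ZMod.card]
    have := Finset.card_le_univ A
    rw [ZMod.card] at this
    omega
  obtain ⟨U, hUW, e⟩ := hU (n : ZMod t) (by rw [this]; exact Finset.mem_univ _)
  exact ⟨U, hUW, (ZMod.natCast_eq_natCast_iff _ _ _).1 e⟩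

theorem count_bound {α : Type*} (f : α → ℕ) (a : ℕ → ℕ) (A : ℕ) (I : Finset ℕ) (W : Multiset α)
    (h : ∀ x ∈ W, A ≤ f x + ∑ i ∈ I, if f x = a i then A - a i else 0) :
    A * Multiset.card W ≤
      fsum f W + ∑ i ∈ I, (A - a i) * Multiset.card (W.filter fun x => f x = a i) := by
  induction W using Multiset.induction_on with
  | empty => simp
  | cons x W ih =>
    have h1 := ih (fun y hy => h y (Multiset.mem_cons_of_mem hy))
    have h2 := h x (Multiset.mem_cons_self x W)
    have h3 : ∑ i ∈ I, (A - a i) * Multiset.card ((x ::ₘ W).filter fun x => f x = a i)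
        = (∑ i ∈ I, if f x = a i then A - a i else 0) +
          ∑ i ∈ I, (A - a i) * Multiset.card (W.filter fun x => f x = a i) := by
      rw [← Finset.sum_add_distrib]
      refine Finset.sum_congr rfl fun i _ => ?_
      by_cases hi : f x = a i
      · rw [Multiset.filter_cons_of_pos (p := fun x => f x = a i) W hi, if_pos hi, Multiset.card_cons]; ring
      · rw [Multiset.filter_cons_of_neg (p := fun x => f x = a i) W hi, if_neg hi]; ring
    rw [fsum_cons, h3, Multiset.card_cons]
    linarith [mul_add A (Multiset.card W) 1]

theorem Mset_bdd (p : ℕ) (S : Multiset (ZMod p)) :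
    BddAbove {t | ∃ T ≤ S, SigmaIndex p T = Set.Icc 1 t} := by
  refine ⟨p, ?_⟩
  rintro t ⟨T, -, e⟩
  by_contra hlt
  have : t ∈ SigmaIndex p T := by rw [e]; constructor <;> omega
  obtain ⟨U, -, -, -, h⟩ := this
  omega

theorem Mset_ne (p : ℕ) (S : Multiset (ZMod p)) :
    {t | ∃ T ≤ S, SigmaIndex p T = Set.Icc 1 t}.Nonempty := by
  refine ⟨0, 0, Multiset.zero_le S, ?_⟩
  ext s
  simp only [SigmaIndex, Set.mem_ofPred_eq, Set.mem_Icc]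
  constructor
  · rintro ⟨T, hT, e, h1, h2⟩
    have : T = 0 := by simpa using hT
    subst this
    simp [sigmaOne] at e
    omega
  · rintro ⟨h1, h2⟩; omega

theorem Mfun_ge (p : ℕ) (S T : Multiset (ZMod p)) (n : ℕ) (h : T ≤ S)
    (e : SigmaIndex p T = Set.Icc 1 n) : n ≤ Mfun p S :=
  le_csSup (Mset_bdd p S) ⟨T, h, e⟩

theorem Mfun_mem (p : ℕ) (S : Multiset (ZMod p)) :
    ∃ T ≤ S, SigmaIndex p T = Set.Icc 1 (Mfun p S) :=
  Nat.sSup_mem (Mset_ne p S) (Mset_bdd p S)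

theorem Mfun_le (p : ℕ) (S : Multiset (ZMod p)) : Mfun p S ≤ p := by
  obtain ⟨T, -, e⟩ := Mfun_mem p S
  by_contra hlt
  have : Mfun p S ∈ SigmaIndex p T := by rw [e]; constructor <;> omega
  obtain ⟨U, -, -, -, h⟩ := this
  omega

theorem le_mfun (p : ℕ) (S : Multiset (ZMod p)) (r : ℕ) (h1 : 1 ≤ r) (h2 : r ≤ p - 1) :
    Mfun p (S.map fun x => (r : ZMod p) * x) ≤ mfun p S := by
  refine le_csSup ⟨p, ?_⟩ ⟨r, h1, h2, rfl⟩
  rintro t ⟨r, -, -, rfl⟩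
  exact Mfun_le p _

theorem nval_one (p : ℕ) (hp : 1 < p) : nval p 1 = 1 := by
  have : Fact (1 < p) := ⟨hp⟩
  simp [nval, ZMod.val_one]

theorem nval_pos (p : ℕ) (hp : 0 < p) (x : ZMod p) : 1 ≤ nval p x := by
  unfold nval
  split_ifs with h
  · exact hp
  · exact Nat.pos_of_ne_zero (by rwa [Ne, ZMod.val_eq_zero])

theorem nval_le (p : ℕ) (hp : 0 < p) (x : ZMod p) : nval p x ≤ p := by
  have : NeZero p := ⟨hp.ne'⟩
  unfold nval
  split_ifs with h
  · exact le_rfl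
  · exact (ZMod.val_lt x).le

theorem nval_cast (p : ℕ) (hp : 0 < p) (x : ZMod p) : (nval p x : ZMod p) = x := by
  have : NeZero p := ⟨hp.ne'⟩
  unfold nval
  split_ifs with h
  · simp [h]
  · simp

theorem nval_natCast (p n : ℕ) (h1 : 1 ≤ n) (h2 : n < p) : nval p (n : ZMod p) = n := by
  unfold nval
  have := ZMod.val_cast_of_lt h2
  rw [if_neg, this]
  intro h
  rw [h, ZMod.val_zero] at this
  omega

theorem mult_bound (p : ℕ) (hp : p.Prime) (S : Multiset (ZMod p)) (hcard : Multiset.card S = p)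
    (h0 : (0 : ZMod p) ∉ S) (H : Multiset (ZMod p)) (hH : H ≤ S)
    (heq : ∀ x ∈ H, ∀ y ∈ H, x = y) : Multiset.card H ≤ mfun p S := by
  have : Fact p.Prime := ⟨hp⟩
  rcases Multiset.empty_or_exists_mem H with rfl | ⟨x, hx⟩
  · simp
  have hHr : H = Multiset.replicate (Multiset.card H) x :=
    Multiset.eq_replicate_card.2 fun y hy => heq y hy x hx
  have hx0 : x ≠ 0 := by
    rintro rfl
    exact h0 (Multiset.mem_of_le hH hx)
  have hxi : x⁻¹ ≠ 0 := inv_ne_zero hx0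
  have hlt := ZMod.val_lt (x⁻¹)
  have hpos : 0 < (x⁻¹).val := Nat.pos_of_ne_zero (by rwa [Ne, ZMod.val_eq_zero])
  refine le_trans ?_ (le_mfun p S (x⁻¹).val hpos (by omega))
  have hle : Multiset.card H ≤ p := (Multiset.card_le_card hH).trans hcard.le
  refine Mfun_ge p _ (H.map fun y => (((x⁻¹).val : ℕ) : ZMod p) * y) _
    (Multiset.map_le_map hH) ?_
  have hm : (H.map fun y => (((x⁻¹).val : ℕ) : ZMod p) * y)
      = Multiset.replicate (Multiset.card H) 1 := by
    conv_lhs => rw [hHr]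
    rw [Multiset.map_replicate, ZMod.natCast_zmod_val, inv_mul_cancel₀ hx0]
  rw [hm]
  have hs : ∀ n, sigmaOne p (Multiset.replicate n 1) = n := by
    intro n
    simp [sigmaOne, nval_one p hp.one_lt]
  ext s
  simp only [SigmaIndex, Set.mem_ofPred_eq, Set.mem_Icc]
  constructor
  · rintro ⟨T, hT, e, h1, h2⟩
    refine ⟨h1, ?_⟩
    obtain ⟨k, hk, rfl⟩ := Multiset.le_replicate_iff.1 hT
    rw [e, hs]; exact hk
  · rintro ⟨h1, h2⟩
    exact ⟨Multiset.replicate s 1, (Multiset.replicate_le_replicate 1).2 h2, (hs s).symm, h1, by omega⟩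

/-- The main combinatorial bound. -/
theorem main_bound (p : ℕ) (hp : p.Prime)
    (S : Multiset (ZMod p)) 
    (hno : ¬ ∃ T ≤ S, T ≠ 0 ∧ ∃ m : ℤ, IsCoprime m (p : ℤ) ∧ sigmaM p m T = p)
    (hmM : mfun p S = Mfun p S)
    (M : ℕ) (hM : M = Mfun p S) (hM0 : 0 < M)
    (t : ℕ) (ht2 : 2 ≤ t) (htp : t < p) (htM : t * M ≤ p)
    (hR : t - 1 ≤ Multiset.card (Rseq p M S t)) :
    ∃ W ≤ Rseq p M S t, Multiset.card W + (t - 1) = Multiset.card (Rseq p M S t) ∧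
      (∀ x ∈ W, nval p ((t : ZMod p) * x) ≠ 1) ∧
      fsum (fun x => nval p ((t : ZMod p) * x)) W + t * M < p := by
  classical
  have hp0 := hp.pos
  set f : ZMod p → ℕ := fun x => nval p ((t : ZMod p) * x) with hf
  set R := Rseq p M S t with hRdef
  have hRS : R ≤ S := Multiset.filter_le _ _
  have hRmem : ∀ x ∈ R, 1 ≤ f x ∧ f x ≤ M ∧ Nat.Coprime (f x) t := fun x hx =>
    (Multiset.mem_filter.1 hx).2
  have htMlt : t * M < p := by
    rcases htM.lt_or_eq with h | h
    · exact h
    · exfalso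
      have : t ∣ p := ⟨M, h.symm⟩
      rcases (Nat.dvd_prime hp).1 this with h | h <;> omega
  have h2M : 2 * M ≤ t * M := Nat.mul_le_mul_right M ht2
  obtain ⟨T, hTS, hT⟩ := Mfun_mem p S
  rw [← hM] at hT
  have hsub : ∀ s, s ≤ M → ∃ U ≤ T, fsum (nval p) U = s := by
    intro s hs
    rcases Nat.eq_zero_or_pos s with rfl | h
    · exact ⟨0, Multiset.zero_le _, fsum_zero _⟩
    · have : s ∈ SigmaIndex p T := by rw [hT]; exact ⟨h, hs⟩
      obtain ⟨U, hU, e, -⟩ := this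
      exact ⟨U, hU, e.symm⟩
  have hlow : ∀ U ≤ T, fsum (nval p) U ≤ p → fsum (nval p) U ≤ M := by
    intro U hU h
    rcases Nat.eq_zero_or_pos (fsum (nval p) U) with h0 | h0
    · omega
    · have : fsum (nval p) U ∈ SigmaIndex p T := ⟨U, hU, rfl, h0, h⟩
      rw [hT] at this
      exact this.2
  have hTM : ∀ x ∈ T, nval p x ≤ M := by
    intro x hx
    have := hlow {x} (Multiset.singleton_le.2 hx) (by simpa [fsum] using nval_le p hp0 x)
    simpa [fsum] using this
  have hTsum : fsum (nval p) T = M := by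
    obtain ⟨U, hU, e⟩ := hsub M le_rfl
    rcases hU.lt_or_eq with h | h
    · exfalso
      obtain ⟨x, hx⟩ := Multiset.lt_iff_cons_le.1 h
      have hxT := hTM x (Multiset.mem_of_le hx (Multiset.mem_cons_self x U))
      have h1 := nval_pos p hp0 x
      have := hlow _ hx (by rw [fsum_cons, e]; omega)
      rw [fsum_cons, e] at this
      omega
    · rw [← h, e]
  have hTf : ∀ x ∈ T, f x = t * nval p x := by
    intro x hx
    have h1 := nval_pos p hp0 x
    have h2 := hTM x hx
    have h3 : t * nval p x ≤ t * M := Nat.mul_le_mul_left t h2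
    have h4 := nval_natCast p (t * nval p x) (Nat.mul_pos (by omega) h1) (by omega)
    rw [← h4, hf]
    push_cast
    rw [nval_cast p hp0]
  have hfT : ∀ U ≤ T, fsum f U = t * fsum (nval p) U := by
    intro U
    induction U using Multiset.induction_on with
    | empty => simp [fsum]
    | cons x U ih =>
      intro h
      have h1 := ih ((Multiset.le_cons_self U x).trans h)
      have h2 := hTf x (Multiset.mem_of_le h (Multiset.mem_cons_self x U))
      rw [fsum_cons, fsum_cons, h1, h2]; ring
  have hTR : T + R ≤ S := by
    rw [hRdef, Rseq]
    conv_rhs => rw [← Multiset.filter_add_not (fun x => 1 ≤ nval p ((t : ZMod p) * x) ∧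
      nval p ((t : ZMod p) * x) ≤ M ∧ Nat.Coprime (nval p ((t : ZMod p) * x)) t) S]
    rw [add_comm]
    refine add_le_add le_rfl ?_
    rw [Multiset.le_filter]
    refine ⟨hTS, ?_⟩
    rintro x hx ⟨-, -, h⟩
    have e : nval p ((t : ZMod p) * x) = t * nval p x := hTf x hx
    rw [e, Nat.coprime_mul_iff_left] at h
    have := (Nat.coprime_self t).1 h.1
    omega
  -- few elements with value one
  have hones : Multiset.card (R.filter fun x => f x = 1) ≤ t - 1 := by
    by_contra hcon
    obtain ⟨O, hO, hOc⟩ := exists_sub_card (s := R.filter fun x => f x = 1)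
      (n := t - 1) (by omega)
    have hO1 : ∀ x ∈ O, f x = 1 := fun x hx =>
      (Multiset.mem_filter.1 (Multiset.mem_of_le hO hx)).2
    have hOR : O ≤ R := hO.trans (Multiset.filter_le _ _)
    have hOs : ∀ U ≤ O, fsum f U = Multiset.card U := by
      intro U hU
      rw [fsum, Multiset.map_congr rfl (fun x hx => hO1 x (Multiset.mem_of_le hU hx))]
      simp
    have hge := Mfun_ge p (S.map fun x => (t : ZMod p) * x)
      ((T + O).map fun x => (t : ZMod p) * x) (min (t * M + (t - 1)) p)
      (Multiset.map_le_map ((add_le_add le_rfl hOR).trans hTR)) ?_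
    · have := le_mfun p S t (by omega) (by omega)
      have : p ≤ M ∨ t * M + (t - 1) ≤ M := by omega
      omega
    · have hsig : ∀ U, sigmaOne p (U.map fun x => (t : ZMod p) * x) = fsum f U := by
        intro U
        simp [sigmaOne, fsum, hf]
      ext s
      simp only [SigmaIndex, Set.mem_ofPred_eq, Set.mem_Icc]
      constructor
      · rintro ⟨V, hV, e, h1, h2⟩
        refine ⟨h1, ?_⟩
        have h3 : sigmaOne p V ≤ _ := fsum_mono (nval p) hV
        have h4 : fsum (nval p) ((T + O).map fun x => (t : ZMod p) * x) = fsum f (T + O) :=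
          hsig _
        rw [h4, fsum_add, hfT T le_rfl, hTsum, hOs O le_rfl, hOc, ← e] at h3
        exact le_min h3 h2
      · rintro ⟨h1, h2⟩
        have h3 := h2.trans (min_le_left _ _)
        have h4 := h2.trans (min_le_right _ _)
        have hq : s / t ≤ M := by
          rw [← Nat.lt_succ_iff, Nat.div_lt_iff_lt_mul (by omega)]
          rw [Nat.succ_mul, mul_comm M t]; omega
        have hr : s % t < t := Nat.mod_lt _ (by omega)
        obtain ⟨U, hU, eU⟩ := hsub _ hq
        obtain ⟨V, hV, eV⟩ := exists_sub_card (s := O) (n := s % t) (by omega)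
        refine ⟨(U + V).map fun x => (t : ZMod p) * x, Multiset.map_le_map (add_le_add hU hV),
          ?_, h1, h4⟩
        rw [hsig, fsum_add, hfT U hU, hOs V hV, eU, eV]
        exact (Nat.div_add_mod s t).symm
  obtain ⟨P, hP1, hP2, hPc⟩ : ∃ P, (R.filter fun x => f x = 1) ≤ P ∧ P ≤ R ∧
      Multiset.card P = t - 1 := by
    obtain ⟨Q, hQ, hQc⟩ := exists_sub_card (s := R.filter fun x => ¬ f x = 1)
      (n := t - 1 - Multiset.card (R.filter fun x => f x = 1)) (by
        have := congrArg Multiset.card (Multiset.filter_add_not (fun x => f x = 1) R)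
        rw [Multiset.card_add] at this
        omega)
    refine ⟨(R.filter fun x => f x = 1) + Q, Multiset.le_add_right _ _, ?_, ?_⟩
    · conv_rhs => rw [← Multiset.filter_add_not (fun x => f x = 1) R]
      exact add_le_add le_rfl hQ
    · rw [Multiset.card_add]; omega
  obtain ⟨W, hW⟩ := Multiset.le_iff_exists_add.1 hP2
  have hWR : W ≤ R := by rw [hW]; exact Multiset.le_add_left _ _
  refine ⟨W, hWR, ?_, ?_, ?_⟩
  · rw [hW, Multiset.card_add]; omega
  · intro x hx h1
    have h2 := congrArg (Multiset.countP fun x => f x = 1) hW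
    have h3 : (R.filter fun x => f x = 1).countP (fun x => f x = 1) ≤ P.countP fun x => f x = 1 :=
      Multiset.countP_le_of_le _ hP1
    have h4 : 0 < W.countP fun x => f x = 1 := Multiset.countP_pos.2 ⟨x, hx, h1⟩
    rw [Multiset.countP_filter] at h3
    simp only [and_self] at h3
    rw [Multiset.countP_add] at h2
    omega
  · by_contra hcon
    obtain ⟨V, hV, hV1, hV2⟩ := greedy f M (p - t * M) hM0 W
      (fun x hx => (hRmem x (Multiset.mem_of_le hWR hx)).2.1) (by omega)
    have hPM : fsum f P ≤ (t - 1) * M := by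
      rw [← hPc]
      exact fsum_le f M P fun x hx => (hRmem x (Multiset.mem_of_le hP2 hx)).2.1
    have htt : (t - 1) * M + M = t * M := by
      obtain ⟨q, rfl⟩ : ∃ q, t = q + 1 := ⟨t - 1, by omega⟩
      simp; ring
    obtain ⟨U, hU, hUm⟩ := residues_full f t (by omega) P
      (fun x hx => (hRmem x (Multiset.mem_of_le hP2 hx)).2.2) (by omega) (p - fsum f V)
    have hUP := fsum_mono f hU
    have hle : fsum f U ≤ p - fsum f V := by omega
    obtain ⟨q, hq⟩ := (Nat.modEq_iff_dvd' hle).1 hUm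
    have hqM : q ≤ M := by
      have : t * q ≤ t * M := by omega
      exact Nat.le_of_mul_le_mul_left this (by omega)
    obtain ⟨Z, hZ, eZ⟩ := hsub q hqM
    have hs : fsum f (Z + (U + V)) = p := by
      rw [fsum_add, fsum_add, hfT Z hZ, eZ]; omega
    apply hno
    refine ⟨Z + (U + V), ?_, ?_, (t : ℤ), ?_, ?_⟩
    · refine le_trans (add_le_add hZ ?_) hTR
      rw [hW]; exact add_le_add hU hV
    · intro h
      rw [h, fsum_zero] at hs; omega
    · rw [Nat.isCoprime_iff_coprime]
      exact ((Nat.Prime.coprime_iff_not_dvd hp).2 fun h => absurd (Nat.le_of_dvd (by omega) h) (by omega)).symm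
    · refine Eq.trans ?_ hs
      simp [sigmaM, fsum, hf]

/-- Lemma 4.7: with `M = M(S)`, `k = ⌊p/M⌋`, `t ∈ [2, k]`, and
`1 = a₁ < a₂ < ⋯` the increasing enumeration of the positive integers coprime
to `t`, if `M ≤ (p - 2t + w·a_{u+1} + 2)/(t + ∑_{i=2}^u aᵢ)` for some
`w, u ≥ 0`, then `|R_t| ≤ (p - (t + ∑_{i=2}^u aᵢ)M - 2t + 2)/a_{u+1}
+ δ_u(u-1)M + 2t + w`, where `δ_u = 0` for `u = 0` and `δ_u = 1` for `u ≥ 1`. -/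
theorem stmt_12 (p : ℕ) (hp : p.Prime) (hbig : 24138 < p)
    (S : Multiset (ZMod p)) (hcard : Multiset.card S = p)
    (h0 : (0 : ZMod p) ∉ S) (h1 : (1 : ZMod p) ∈ S)
    (hno : ¬ ∃ T ≤ S, T ≠ 0 ∧ ∃ m : ℤ, IsCoprime m (p : ℤ) ∧ sigmaM p m T = p)
    (hmM : mfun p S = Mfun p S)
    (M k : ℕ) (hM : M = Mfun p S) (hk : k = p / M)
    (t : ℕ) (ht2 : 2 ≤ t) (htk : t ≤ k)
    (a : ℕ → ℕ)
    (ha1 : a 1 = 1)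
    (hapos : ∀ i, 1 ≤ i → 0 < a i)
    (hacop : ∀ i, 1 ≤ i → Nat.Coprime (a i) t)
    (hamono : ∀ i j, 1 ≤ i → i < j → a i < a j)
    (hasurj : ∀ x : ℕ, 0 < x → Nat.Coprime x t → ∃ i, 1 ≤ i ∧ a i = x)
    (w u : ℕ)
    (hcond : (M : ℚ) ≤ ((p : ℚ) - 2 * t + (w : ℚ) * a (u + 1) + 2) /
        ((t : ℚ) + ∑ i ∈ Finset.Icc 2 u, (a i : ℚ))) :
    (Multiset.card (Rseq p M S t) : ℚ) ≤
      ((p : ℚ) - ((t : ℚ) + ∑ i ∈ Finset.Icc 2 u, (a i : ℚ)) * M - 2 * t + 2) /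
          (a (u + 1) : ℚ)
        + (if u = 0 then 0 else 1) * ((u : ℚ) - 1) * M + 2 * t + w := by
  classical
  have hM0 : 0 < M := by
    rcases Nat.eq_zero_or_pos M with h | h
    · subst h; simp at hk; omega
    · exact h
  have htM : t * M ≤ p := by
    rw [hk] at htk
    exact (Nat.le_div_iff_mul_le hM0).1 htk
  have hApos : (0 : ℚ) < a (u + 1) := by exact_mod_cast hapos (u + 1) (by omega)
  have ht2' : (2 : ℚ) ≤ t := by exact_mod_cast ht2
  have hM0' : (1 : ℚ) ≤ M := by exact_mod_cast hM0
  have hsum0 : (0 : ℚ) ≤ ∑ i ∈ Finset.Icc 2 u, (a i : ℚ) :=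
    Finset.sum_nonneg fun i _ => Nat.cast_nonneg _
  rw [le_div_iff₀ (by linarith)] at hcond
  set sa := ∑ i ∈ Finset.Icc 2 u, (a i : ℚ) with hsa
  set A : ℚ := (a (u + 1) : ℚ) with hA
  have hdel : (0 : ℚ) ≤ (if u = 0 then 0 else 1) * ((u : ℚ) - 1) * M := by
    split_ifs with h
    · simp
    · have : (1 : ℚ) ≤ u := by exact_mod_cast Nat.pos_of_ne_zero h
      have : (0 : ℚ) ≤ (u : ℚ) - 1 := by linarith
      positivity
  have hfrac : -(w : ℚ) ≤ ((p : ℚ) - ((t : ℚ) + sa) * M - 2 * t + 2) / A := by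
    rw [le_div_iff₀ hApos]; linarith
  -- trivial case
  by_cases hR : Multiset.card (Rseq p M S t) < t
  · have : (Multiset.card (Rseq p M S t) : ℚ) ≤ t := by exact_mod_cast hR.le
    linarith
  have htp : t < p := by
    by_contra hcon
    have htle : t * 1 ≤ t * M := Nat.mul_le_mul_left t hM0
    have e : t = p := by omega
    have hM1 : M = 1 := by
      have : t * M ≤ t * 1 := by omega
      have := Nat.le_of_mul_le_mul_left this (by omega)
      omega
    apply hR
    have : Rseq p M S t = 0 := by
      rw [Rseq, Multiset.filter_eq_nil]
      rintro x - ⟨-, h, -⟩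
      rw [e] at h
      simp [nval] at h
      omega
    rw [this]; simp; omega
  have : Fact p.Prime := ⟨hp⟩
  obtain ⟨W, hWR, hWc, hW1, hWs⟩ := main_bound p hp S hno hmM M hM hM0 t ht2 htp htM (by omega)
  set f : ZMod p → ℕ := fun x => nval p ((t : ZMod p) * x) with hf
  have hWf : ∀ x ∈ W, 1 ≤ f x ∧ f x ≤ M ∧ Nat.Coprime (f x) t := fun x hx =>
    (Multiset.mem_filter.1 (Multiset.mem_of_le hWR hx)).2
  have hWS : W ≤ S := hWR.trans (Multiset.filter_le _ _)
  have hcardR : (Multiset.card (Rseq p M S t) : ℚ) = Multiset.card W + t - 1 := by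
    rw [← hWc]
    push_cast [Nat.cast_sub (show 1 ≤ t by omega)]
    ring
  have hWs' : (fsum f W : ℚ) + t * M < p := by exact_mod_cast hWs
  rw [hcardR]
  rcases Nat.eq_zero_or_pos u with hu | hu
  · have h2 := count_bound f a 2 ∅ W (by
      intro x hx
      have h1 := hW1 x hx
      have h2 := (hWf x hx).1
      have : f x ≠ 1 := h1
      simp; omega)
    have h2' : 2 * (Multiset.card W : ℚ) ≤ fsum f W := by
      have : 2 * Multiset.card W ≤ fsum f W := by simpa using h2
      exact_mod_cast this
    have hA1 : A = 1 := by rw [hA, hu]; simp [ha1]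
    have hsa0 : sa = 0 := by rw [hsa, hu]; simp
    rw [hA1, hsa0] at hcond
    rw [hA1, hsa0, if_pos hu, div_one]
    simp only [add_zero, mul_one, zero_mul] at hcond ⊢
    have hw : (0 : ℚ) ≤ w := Nat.cast_nonneg _
    linarith
  · have h2 := count_bound f a (a (u + 1)) (Finset.Icc 2 u) W (by
      intro x hx
      obtain ⟨h1, h2, h3⟩ := hWf x hx
      obtain ⟨j, hj, e⟩ := hasurj (f x) h1 h3
      have hj1 : j ≠ 1 := by
        rintro rfl
        exact hW1 x hx (e.symm.trans ha1)
      by_cases hju : j ≤ u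
      · have hmem : j ∈ Finset.Icc 2 u := Finset.mem_Icc.2 ⟨by omega, hju⟩
        have := Finset.single_le_sum
          (f := fun i => if f x = a i then a (u + 1) - a i else 0)
          (fun i _ => Nat.zero_le _) hmem
        simp only [e, if_true] at this
        omega
      · rcases Nat.lt_or_ge (u + 1) j with h | h
        · have := hamono (u + 1) j (by omega) h
          omega
        · have : j = u + 1 := by omega
          subst this
          omega)
    have h3 : ∀ i ∈ Finset.Icc 2 u, (a (u + 1) - a i) * Multiset.card (W.filter fun x => f x = a i)
        ≤ (a (u + 1) - a i) * M := by
      intro i _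
      refine Nat.mul_le_mul_left _ ?_
      rw [hM, ← hmM]
      refine mult_bound p hp S hcard h0 _ ((Multiset.filter_le _ _).trans hWS) ?_
      intro x hx y hy
      have e1 := (Multiset.mem_filter.1 hx).2
      have e2 := (Multiset.mem_filter.1 hy).2
      have e3 : nval p ((t : ZMod p) * x) = nval p ((t : ZMod p) * y) := e1.trans e2.symm
      have e4 := congrArg (fun n : ℕ => (n : ZMod p)) e3
      simp only [nval_cast p hp.pos] at e4
      refine mul_left_cancel₀ ?_ e4
      intro h
      rw [ZMod.natCast_eq_zero_iff] at h
      exact absurd (Nat.le_of_dvd (by omega) h) (by omega)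
    have h4 := h2.trans (Nat.add_le_add_left (Finset.sum_le_sum h3) _)
    have h5 : A * Multiset.card W ≤ fsum f W + ∑ i ∈ Finset.Icc 2 u, (A - a i) * M := by
      have h6 : ((a (u + 1) * Multiset.card W : ℕ) : ℚ) ≤
        ((fsum f W + ∑ i ∈ Finset.Icc 2 u, (a (u + 1) - a i) * M : ℕ) : ℚ) := by
        exact_mod_cast h4
      push_cast at h6
      convert h6 using 2
      refine Finset.sum_congr rfl fun i hi => ?_
      rw [Finset.mem_Icc] at hi
      rw [Nat.cast_sub (hamono i (u + 1) (by omega) (by omega)).le]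
    have h6 : ∑ i ∈ Finset.Icc 2 u, (A - a i) * (M : ℚ) = (((u : ℚ) - 1) * A - sa) * M := by
      rw [← Finset.sum_mul, Finset.sum_sub_distrib, Finset.sum_const, Nat.card_Icc, nsmul_eq_mul]
      rw [show u + 1 - 2 = u - 1 by omega, Nat.cast_sub hu, ← hsa, Nat.cast_one]
    rw [h6] at h5
    have hA2 : (2 : ℚ) ≤ A := by
      have := hamono 1 (u + 1) le_rfl (by omega)
      rw [ha1] at this
      rw [hA]
      exact_mod_cast (show 2 ≤ a (u + 1) by omega)
    have hw : (0 : ℚ) ≤ w := Nat.cast_nonneg _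
    rw [if_neg (by omega), one_mul]
    have h7 : (Multiset.card W : ℚ) + t - 1 - ((u : ℚ) - 1) * M - 2 * t - w ≤
        ((p : ℚ) - ((t : ℚ) + sa) * M - 2 * t + 2) / A := by
      rw [le_div_iff₀ hApos]
      nlinarith [mul_nonneg hw hApos.le, mul_nonneg (sub_nonneg.2 hA2) (by linarith : (0 : ℚ) ≤ t)]
    linarith
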